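/- arXiv:1412.8257 — 2 statements merged into one kernel-verified Lean document; each statement's English description precedes it below -/
import Mathlib

section
/- Let k ≥ 2 and m ≥ 1 be integers, and for each a ∈ {0, 1/(2m), …, (2m−1)/(2m)} let h_a be holomorphic on ℍ with |h_a(τ)| ≤ C e^{−c Im τ} for some constants C, c > 0. Define Φ(τ,z) := Σ_a Ê_{k−2}(h_a)(τ) · θ_{m,a}(τ,z). Then the (k−1)-fold iterate of the heat operator annihilates Φ: H_m^{k−1} Φ = 0 on ℍ×ℂ. -/
open Complex MeasureTheory

noncomputable section

/-- The index-`m` theta series `θ_{m,a}`. -/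
def theta (m : ℕ) (a : ℝ) (τ z : ℂ) : ℂ :=
  ∑' n : ℤ, Complex.exp (2 * (Real.pi : ℂ) * Complex.I * (m : ℂ) *
    (((n : ℂ) + (a : ℂ)) ^ 2 * τ + 2 * ((n : ℂ) + (a : ℂ)) * z))

/-- Holomorphic Wirtinger derivative. -/
def wder (f : ℂ → ℂ) (w : ℂ) : ℂ :=
  (fderiv ℝ f w 1 - Complex.I * fderiv ℝ f w Complex.I) / 2

/-- The index-`m` heat operator `H_m = 8πim ∂_τ − ∂_z²`. -/
def heatOp (m : ℕ) (F : ℂ → ℂ → ℂ) : ℂ → ℂ → ℂ :=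
  fun τ z => 8 * (Real.pi : ℂ) * Complex.I * (m : ℂ) * wder (fun w => F w z) τ
    - wder (wder (F τ)) z

/-- The non-holomorphic Eichler integral
`Ê_n(h)(τ) = conj(∫_τ^{i∞} h(t)(t−τ̄)^n dt)`, the integral taken along the
vertical ray `t = τ + is`, `s ∈ (0,∞)`. -/
def Ehat (n : ℕ) (h : ℂ → ℂ) (τ : ℂ) : ℂ :=
  (starRingEnd ℂ)
    (∫ s in Set.Ioi (0:ℝ),
      h (τ + (s : ℂ) * Complex.I) *
        ((τ + (s : ℂ) * Complex.I) - (starRingEnd ℂ) τ) ^ n * Complex.I)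

/-- The `n`-th summand of the theta series `θ_{m,a}`. -/
def thetaTerm (m : ℕ) (a : ℝ) (n : ℤ) (τ z : ℂ) : ℂ :=
  Complex.exp (2 * (Real.pi : ℂ) * Complex.I * (m : ℂ) *
    (((n : ℂ) + (a : ℂ)) ^ 2 * τ + 2 * ((n : ℂ) + (a : ℂ)) * z))

theorem hasDerivAt_thetaTerm_left (m : ℕ) (a : ℝ) (n : ℤ) (τ z : ℂ) :
    HasDerivAt (fun w => thetaTerm m a n w z)
      (2 * (Real.pi : ℂ) * Complex.I * (m : ℂ) * ((n : ℂ) + (a : ℂ)) ^ 2 *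
        thetaTerm m a n τ z) τ := by
  have := ((((hasDerivAt_id τ).const_mul (((n : ℂ) + (a : ℂ)) ^ 2)).add_const
    (2 * ((n : ℂ) + (a : ℂ)) * z)).const_mul (2 * (Real.pi : ℂ) * Complex.I * (m : ℂ))).cexp
  refine this.congr_deriv ?_
  simp only [thetaTerm, id]
  ring

theorem hasDerivAt_thetaTerm_right (m : ℕ) (a : ℝ) (n : ℤ) (τ z : ℂ) :
    HasDerivAt (thetaTerm m a n τ)
      (4 * (Real.pi : ℂ) * Complex.I * (m : ℂ) * ((n : ℂ) + (a : ℂ)) *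
        thetaTerm m a n τ z) z := by
  have := ((((hasDerivAt_id z).const_mul (2 * ((n : ℂ) + (a : ℂ)))).const_add
    (((n : ℂ) + (a : ℂ)) ^ 2 * τ)).const_mul (2 * (Real.pi : ℂ) * Complex.I * (m : ℂ))).cexp
  refine this.congr_deriv ?_
  simp only [thetaTerm, id]
  ring

theorem norm_thetaTerm_le (m : ℕ) (a : ℝ) (n : ℤ) {S T : ℝ} (hT : 0 ≤ T) {τ z : ℂ}
    (hτ : T ≤ τ.im) (hz : |z.im| ≤ S) :
    ‖thetaTerm m a n τ z‖ ≤ Real.exp (Real.pi * m * (2 * T * a ^ 2 + 4 * S * |a|)) *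
      Real.exp (-Real.pi * ((m * T) * (n : ℝ) ^ 2 - 2 * (2 * m * S) * |(n : ℝ)|)) := by
  have hre : (2 * (Real.pi : ℂ) * Complex.I * (m : ℂ) *
      (((n : ℂ) + (a : ℂ)) ^ 2 * τ + 2 * ((n : ℂ) + (a : ℂ)) * z)).re =
      -(2 * Real.pi * m * (((n : ℝ) + a) ^ 2 * τ.im + 2 * ((n : ℝ) + a) * z.im)) := by
    rw [show (2 * (Real.pi : ℂ) * Complex.I * (m : ℂ) *
      (((n : ℂ) + (a : ℂ)) ^ 2 * τ + 2 * ((n : ℂ) + (a : ℂ)) * z)) =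
      ((2 * Real.pi * m * ((n : ℝ) + a) ^ 2 : ℝ) : ℂ) * (Complex.I * τ) +
      ((2 * Real.pi * m * 2 * ((n : ℝ) + a) : ℝ) : ℂ) * (Complex.I * z) by push_cast; ring]
    rw [Complex.add_re, Complex.re_ofReal_mul, Complex.re_ofReal_mul, Complex.I_mul_re,
      Complex.I_mul_re]
    ring
  rw [thetaTerm, Complex.norm_exp, hre, ← Real.exp_add]
  apply Real.exp_le_exp.mpr
  have hS : 0 ≤ S := (abs_nonneg _).trans hz
  have h1 : ((n : ℝ) ^ 2 / 2 - a ^ 2) * T ≤ ((n : ℝ) + a) ^ 2 * τ.im :=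
    (mul_le_mul_of_nonneg_right (by nlinarith [sq_nonneg ((n : ℝ) + 2 * a)]) hT).trans
      (mul_le_mul_of_nonneg_left hτ (sq_nonneg _))
  have h2 : -((|(n : ℝ)| + |a|) * S) ≤ ((n : ℝ) + a) * z.im := by
    refine (neg_le_neg ?_).trans (neg_abs_le _)
    rw [abs_mul]
    exact mul_le_mul (abs_add_le _ _) hz (abs_nonneg _) (by positivity)
  have h3 : 0 ≤ 2 * Real.pi * m := by positivity
  have := mul_le_mul_of_nonneg_left (add_le_add h1 (mul_le_mul_of_nonneg_left h2 zero_le_two)) h3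
  nlinarith [this]

theorem exists_summable_thetaTerm_bound {m : ℕ} (hm : 1 ≤ m) (a S : ℝ) {T : ℝ} (hT : 0 < T) :
    ∃ u : ℤ → ℝ, Summable u ∧ (Summable fun n : ℤ => |(n : ℝ) + a| * u n) ∧
      ∀ (n : ℤ) (τ z : ℂ), T ≤ τ.im → |z.im| ≤ S → ‖thetaTerm m a n τ z‖ ≤ u n := by
  have hmT : 0 < m * T := mul_pos (by exact_mod_cast hm) hT
  have h0 := (summable_pow_mul_jacobiTheta₂_term_bound (2 * m * S) hmT 0).mul_left
    (Real.exp (Real.pi * m * (2 * T * a ^ 2 + 4 * S * |a|)))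
  have h1 := (summable_pow_mul_jacobiTheta₂_term_bound (2 * m * S) hmT 1).mul_left
    (Real.exp (Real.pi * m * (2 * T * a ^ 2 + 4 * S * |a|)))
  simp only [pow_zero, one_mul, pow_one, Int.cast_abs] at h0 h1
  refine ⟨_, h0, ?_, fun n τ z hτ hz => norm_thetaTerm_le m a n hT.le hτ hz⟩
  refine Summable.of_nonneg_of_le (fun n => by positivity) (fun n => ?_) (h1.add (h0.mul_left |a|))
  refine (mul_le_mul_of_nonneg_right (abs_add_le _ _) (by positivity)).trans_eq ?_
  ring

theorem differentiableAt_theta_left {m : ℕ} (hm : 1 ≤ m) (a : ℝ) {τ : ℂ} (hτ : 0 < τ.im)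
    (z : ℂ) : DifferentiableAt ℂ (fun w => theta m a w z) τ ∧
      HasSum (fun n : ℤ => 2 * (Real.pi : ℂ) * Complex.I * (m : ℂ) * ((n : ℂ) + (a : ℂ)) ^ 2 *
        thetaTerm m a n τ z) (deriv (fun w => theta m a w z) τ) := by
  obtain ⟨u, hu, -, hle⟩ := exists_summable_thetaTerm_bound hm a |z.im| (half_pos hτ)
  have hU : IsOpen {w : ℂ | τ.im / 2 < w.im} := isOpen_lt continuous_const Complex.continuous_im
  have hmem : τ ∈ {w : ℂ | τ.im / 2 < w.im} := half_lt_self hτ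
  have hd (n : ℤ) : DifferentiableOn ℂ (fun w => thetaTerm m a n w z) {w : ℂ | τ.im / 2 < w.im} :=
    fun w _ => (hasDerivAt_thetaTerm_left m a n w z).differentiableAt.differentiableWithinAt
  have hb (n : ℤ) (w : ℂ) (hw : w ∈ {w : ℂ | τ.im / 2 < w.im}) : ‖thetaTerm m a n w z‖ ≤ u n :=
    hle n w z (le_of_lt hw) le_rfl
  refine ⟨(differentiableOn_tsum_of_summable_norm hu hd hU hb).differentiableAt
    (hU.mem_nhds hmem), ?_⟩
  have := hasSum_deriv_of_summable_norm hu hd hU hb hmem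
  simp only [(hasDerivAt_thetaTerm_left m a _ τ z).deriv] at this
  exact this

theorem hasSum_deriv_theta_right {m : ℕ} (hm : 1 ≤ m) (a : ℝ) {τ : ℂ} (hτ : 0 < τ.im) :
    Differentiable ℂ (theta m a τ) ∧
    (∀ z, HasSum (fun n : ℤ =>
      (4 * (Real.pi : ℂ) * Complex.I * (m : ℂ) * ((n : ℂ) + (a : ℂ))) ^ 2 *
        thetaTerm m a n τ z) (deriv (deriv (theta m a τ)) z)) := by
  have hU (S : ℝ) : IsOpen {z : ℂ | |z.im| < S} :=
    isOpen_lt (continuous_abs.comp Complex.continuous_im) continuous_const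
  have hmem (z : ℂ) : z ∈ {w : ℂ | |w.im| < |z.im| + 1} := lt_add_one |z.im|
  have hd (n : ℤ) : Differentiable ℂ (thetaTerm m a n τ) :=
    fun w => (hasDerivAt_thetaTerm_right m a n τ w).differentiableAt
  have hderiv (n : ℤ) : deriv (thetaTerm m a n τ) = fun w =>
      4 * (Real.pi : ℂ) * Complex.I * (m : ℂ) * ((n : ℂ) + (a : ℂ)) * thetaTerm m a n τ w :=
    funext fun w => (hasDerivAt_thetaTerm_right m a n τ w).deriv
  have hfirst : deriv (theta m a τ) = fun z => ∑' n : ℤ, deriv (thetaTerm m a n τ) z := by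
    ext z
    obtain ⟨u, hu, -, hle⟩ := exists_summable_thetaTerm_bound hm a (|z.im| + 1) hτ
    exact (hasSum_deriv_of_summable_norm hu (fun n => (hd n).differentiableOn) (hU _)
      (fun n w hw => hle n τ w le_rfl (le_of_lt hw)) (hmem z)).tsum_eq.symm
  refine ⟨fun z => ?_, fun z => ?_⟩
  · obtain ⟨u, hu, -, hle⟩ := exists_summable_thetaTerm_bound hm a (|z.im| + 1) hτ
    exact (differentiableOn_tsum_of_summable_norm hu (fun n => (hd n).differentiableOn) (hU _)
      (fun n w hw => hle n τ w le_rfl (le_of_lt hw))).differentiableAt ((hU _).mem_nhds (hmem z))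
  · obtain ⟨u, -, hu, hle⟩ := exists_summable_thetaTerm_bound hm a (|z.im| + 1) hτ
    rw [hfirst]
    have hb (n : ℤ) (w : ℂ) (hw : w ∈ {w : ℂ | |w.im| < |z.im| + 1}) :
        ‖deriv (thetaTerm m a n τ) w‖ ≤
          ‖4 * (Real.pi : ℂ) * Complex.I * (m : ℂ)‖ * (|(n : ℝ) + a| * u n) := by
      rw [hderiv n, norm_mul, norm_mul, mul_assoc]
      refine mul_le_mul_of_nonneg_left (mul_le_mul ?_ (hle n τ w le_rfl (le_of_lt hw))
        (norm_nonneg _) (abs_nonneg _)) (norm_nonneg _)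
      rw [show (n : ℂ) + (a : ℂ) = (((n : ℝ) + a : ℝ) : ℂ) by push_cast; ring, Complex.norm_real,
        Real.norm_eq_abs]
    have := hasSum_deriv_of_summable_norm (F := fun n => deriv (thetaTerm m a n τ))
      (hu.mul_left ‖4 * (Real.pi : ℂ) * Complex.I * (m : ℂ)‖)
      (fun n => (by rw [hderiv n]; exact ((hd n).const_mul _).differentiableOn)) (hU _) hb (hmem z)
    refine this.congr_fun fun n => ?_
    rw [hderiv n, ((hasDerivAt_thetaTerm_right m a n τ z).const_mul _).deriv]
    ring

theorem theta_heat_equation {m : ℕ} (hm : 1 ≤ m) (a : ℝ) {τ : ℂ} (hτ : 0 < τ.im) (z : ℂ) :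
    8 * (Real.pi : ℂ) * Complex.I * (m : ℂ) * deriv (fun w => theta m a w z) τ =
      deriv (deriv (theta m a τ)) z := by
  refine (((differentiableAt_theta_left hm a hτ z).2.mul_left
    (8 * (Real.pi : ℂ) * Complex.I * (m : ℂ))).congr_fun ?_).unique
    ((hasSum_deriv_theta_right hm a hτ).2 z)
  intro n
  ring

/-- `f` is real differentiable at `w` with holomorphic Wirtinger derivative `d`. -/
def HasWder (f : ℂ → ℂ) (d w : ℂ) : Prop :=
  ∃ L : ℂ →L[ℝ] ℂ, HasFDerivAt f L w ∧ (L 1 - Complex.I * L Complex.I) / 2 = d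

namespace HasWder

variable {f g : ℂ → ℂ} {d e w : ℂ}

theorem wder_eq (hf : HasWder f d w) : wder f w = d := by
  obtain ⟨L, hL, rfl⟩ := hf
  rw [wder, hL.fderiv]

theorem congr_of_eventuallyEq (hf : HasWder f d w) (h : g =ᶠ[nhds w] f) : HasWder g d w := by
  obtain ⟨L, hL, rfl⟩ := hf
  exact ⟨L, hL.congr_of_eventuallyEq h, rfl⟩

theorem mul (hf : HasWder f d w) (hg : HasWder g e w) :
    HasWder (fun x => f x * g x) (d * g w + f w * e) w := by
  obtain ⟨L, hL, rfl⟩ := hf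
  obtain ⟨M, hM, rfl⟩ := hg
  refine ⟨_, hL.mul hM, ?_⟩
  simp only [add_apply, FunLike.coe_smul, Pi.smul_apply, smul_eq_mul]
  ring

theorem const_mul (c : ℂ) (hf : HasWder f d w) : HasWder (fun x => c * f x) (c * d) w := by
  obtain ⟨L, hL, rfl⟩ := hf
  refine ⟨_, hL.const_mul c, ?_⟩
  simp only [FunLike.coe_smul, Pi.smul_apply, smul_eq_mul]
  ring

theorem sum {ι : Type*} {s : Finset ι} {F : ι → ℂ → ℂ} {D : ι → ℂ}
    (h : ∀ i ∈ s, HasWder (F i) (D i) w) :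
    HasWder (fun x => ∑ i ∈ s, F i x) (∑ i ∈ s, D i) w := by
  choose! L hL hD using h
  refine ⟨_, HasFDerivAt.fun_sum hL, ?_⟩
  rw [← Finset.sum_congr rfl hD, _root_.sum_apply, _root_.sum_apply,
    Finset.mul_sum, ← Finset.sum_sub_distrib, Finset.sum_div]

theorem pow (hf : HasWder f d w) (n : ℕ) :
    HasWder (fun x => f x ^ n) (n * f w ^ (n - 1) * d) w := by
  obtain ⟨L, hL, rfl⟩ := hf
  refine ⟨_, hL.pow n, ?_⟩
  simp only [FunLike.coe_smul, Pi.smul_apply, smul_eq_mul, nsmul_eq_mul]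
  ring

end HasWder

theorem HasDerivAt.hasWder {f : ℂ → ℂ} {d w : ℂ} (hf : HasDerivAt f d w) : HasWder f d w := by
  refine ⟨_, hf.hasFDerivAt.restrictScalars ℝ, ?_⟩
  simp only [ContinuousLinearMap.coe_restrictScalars', ContinuousLinearMap.toSpanSingleton_apply,
    smul_eq_mul]
  linear_combination (-d / 2) * Complex.I_mul_I

theorem HasDerivAt.hasWder_conj {f : ℂ → ℂ} {d w : ℂ} (hf : HasDerivAt f d w) :
    HasWder (fun x => (starRingEnd ℂ) (f x)) 0 w := by
  refine ⟨_, Complex.conjCLE.toContinuousLinearMap.hasFDerivAt.comp w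
    (hf.hasFDerivAt.restrictScalars ℝ), ?_⟩
  simp only [ContinuousLinearMap.comp_apply, ContinuousLinearMap.coe_restrictScalars',
    ContinuousLinearMap.toSpanSingleton_apply, smul_eq_mul, ContinuousLinearEquiv.coe_coe,
    Complex.conjCLE_apply, map_mul, map_one, Complex.conj_I]
  linear_combination ((starRingEnd ℂ) d / 2) * Complex.I_mul_I

theorem hasWder_conj_sub_conj (w : ℂ) :
    HasWder (fun x => (starRingEnd ℂ) (x - (starRingEnd ℂ) x)) (-1) w := by
  have h1 := (hasDerivAt_id w).hasWder.const_mul (-1)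
  have h2 := (hasDerivAt_id w).hasWder_conj
  have h3 := HasWder.sum (s := Finset.univ) (F := ![fun x => -1 * id x, fun x => (starRingEnd ℂ) x])
    (D := ![-1 * 1, 0]) (w := w) (fun i _ => by fin_cases i; exacts [h1, h2])
  simp only [Fin.sum_univ_two, Matrix.cons_val_zero, Matrix.cons_val_one, mul_one, add_zero, id,
    Matrix.cons_val_fin_one] at h3
  refine h3.congr_of_eventuallyEq (Filter.Eventually.of_forall fun x => ?_)
  simp only [map_sub, Complex.conj_conj]
  ring

/-- The `j`-th moment of `h` along the vertical ray from `τ` to `i∞`. -/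
def rayMoment (j : ℕ) (h : ℂ → ℂ) (τ : ℂ) : ℂ :=
  ∫ s in Set.Ioi (0 : ℝ), h (τ + (s : ℂ) * Complex.I) * (((s : ℂ) * Complex.I) ^ j * Complex.I)

theorem integrableOn_pow_mul_exp_neg_mul (j : ℕ) {c : ℝ} (hc : 0 < c) :
    IntegrableOn (fun s : ℝ => s ^ j * Real.exp (-c * s)) (Set.Ioi 0) := by
  have := integrableOn_rpow_mul_exp_neg_mul_rpow (s := j) (p := 1)
    (by linarith [(j.cast_nonneg : (0 : ℝ) ≤ j)]) one_pos hc
  simpa only [Real.rpow_natCast, Real.rpow_one] using this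

section

variable {h : ℂ → ℂ} {C c : ℝ}

theorem norm_le_exp_on_ray (hc : 0 < c) (hC : 0 < C)
    (hdecay : ∀ τ : ℂ, 0 < τ.im → ‖h τ‖ ≤ C * Real.exp (-c * τ.im)) {s : ℝ} {τ : ℂ}
    (hs : 0 < s) (hτ : s ≤ τ.im) : ‖h τ‖ ≤ C * Real.exp (-c * s) := by
  refine (hdecay τ (hs.trans_le hτ)).trans (mul_le_mul_of_nonneg_left ?_ hC.le)
  exact Real.exp_le_exp.mpr (by nlinarith)

theorem add_mul_I_im (τ : ℂ) (s : ℝ) : (τ + (s : ℂ) * Complex.I).im = τ.im + s := by simp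

theorem aestronglyMeasurable_ray {g : ℂ → ℂ} (hg : ContinuousOn g {τ : ℂ | 0 < τ.im}) {τ : ℂ}
    (hτ : 0 < τ.im) (j : ℕ) : AEStronglyMeasurable (fun s : ℝ => g (τ + (s : ℂ) * Complex.I) *
      (((s : ℂ) * Complex.I) ^ j * Complex.I)) (volume.restrict (Set.Ioi 0)) := by
  refine ContinuousOn.aestronglyMeasurable ?_ measurableSet_Ioi
  refine ContinuousOn.mul (hg.comp (by fun_prop) fun s hs => ?_) (by fun_prop)
  rw [Set.mem_ofPred_eq, add_mul_I_im]
  exact add_pos hτ hs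

theorem norm_mul_ray_weight (x : ℂ) {s : ℝ} (hs : 0 < s) (j : ℕ) :
    ‖x * (((s : ℂ) * Complex.I) ^ j * Complex.I)‖ = ‖x‖ * s ^ j := by
  rw [norm_mul, norm_mul, norm_pow, norm_mul, Complex.norm_I, Complex.norm_real, Real.norm_eq_abs,
    abs_of_pos hs, mul_one, mul_one]

theorem integrableOn_ray (hhol : DifferentiableOn ℂ h {τ : ℂ | 0 < τ.im}) (hC : 0 < C) (hc : 0 < c)
    (hdecay : ∀ τ : ℂ, 0 < τ.im → ‖h τ‖ ≤ C * Real.exp (-c * τ.im)) {τ : ℂ} (hτ : 0 < τ.im)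
    (j : ℕ) : IntegrableOn (fun s : ℝ => h (τ + (s : ℂ) * Complex.I) *
      (((s : ℂ) * Complex.I) ^ j * Complex.I)) (Set.Ioi 0) := by
  refine ((integrableOn_pow_mul_exp_neg_mul j hc).const_mul C).mono'
    (aestronglyMeasurable_ray hhol.continuousOn hτ j) ?_
  refine (ae_restrict_iff' measurableSet_Ioi).mpr (Filter.Eventually.of_forall fun s hs => ?_)
  rw [norm_mul_ray_weight _ hs]
  have := norm_le_exp_on_ray hc hC hdecay (τ := τ + (s : ℂ) * Complex.I) hs
    (by rw [add_mul_I_im]; linarith)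
  exact (mul_le_mul_of_nonneg_right this (pow_nonneg (le_of_lt hs) j)).trans_eq (by ring)

theorem differentiableAt_rayMoment (hhol : DifferentiableOn ℂ h {τ : ℂ | 0 < τ.im}) (hC : 0 < C)
    (hc : 0 < c) (hdecay : ∀ τ : ℂ, 0 < τ.im → ‖h τ‖ ≤ C * Real.exp (-c * τ.im)) {τ : ℂ}
    (hτ : 0 < τ.im) (j : ℕ) : DifferentiableAt ℂ (rayMoment j h) τ := by
  have hU : IsOpen {τ : ℂ | 0 < τ.im} := isOpen_lt continuous_const Complex.continuous_im
  have hr : 0 < τ.im / 2 := half_pos hτ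
  have him {x y : ℂ} {r : ℝ} (hy : dist x y ≤ r) : y.im - r ≤ x.im := by
    have := (Complex.abs_im_le_norm (x - y)).trans (dist_eq_norm x y ▸ hy)
    rw [Complex.sub_im] at this
    linarith [neg_abs_le (x.im - y.im)]
  have hball {x : ℂ} (hx : x ∈ Metric.ball τ (τ.im / 2)) : τ.im / 2 ≤ x.im := by
    linarith [him (le_of_lt (Metric.mem_ball.mp hx))]
  refine (hasDerivAt_integral_of_dominated_loc_of_deriv_le
    (s := Metric.ball τ (τ.im / 2))
    (F' := fun w (s : ℝ) => deriv h (w + (s : ℂ) * Complex.I) *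
      (((s : ℂ) * Complex.I) ^ j * Complex.I))
    (bound := fun s : ℝ => C / (τ.im / 4) * (s ^ j * Real.exp (-c * s)))
    (Metric.ball_mem_nhds τ hr)
    (Filter.eventually_of_mem (hU.mem_nhds hτ) fun w hw =>
      aestronglyMeasurable_ray hhol.continuousOn hw j)
    (integrableOn_ray hhol hC hc hdecay hτ j)
    (aestronglyMeasurable_ray (hhol.deriv hU).continuousOn hτ j) ?_
    ((integrableOn_pow_mul_exp_neg_mul j hc).const_mul _) ?_).2.differentiableAt
  · refine (ae_restrict_iff' measurableSet_Ioi).mpr (Filter.Eventually.of_forall fun s hs x hx => ?_)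
    rw [Set.mem_Ioi] at hs
    rw [norm_mul_ray_weight _ hs]
    have hball' {y : ℂ} (hy : dist y (x + (s : ℂ) * Complex.I) ≤ τ.im / 4) : s < y.im := by
      have := him hy
      rw [add_mul_I_im] at this
      linarith [hball hx]
    have hd := Complex.norm_deriv_le_of_forall_mem_sphere_norm_le (f := h)
      (c := x + (s : ℂ) * Complex.I) (R := τ.im / 4) (C := C * Real.exp (-c * s)) (by linarith)
      (DifferentiableOn.diffContOnCl_ball (hhol.mono fun y hy => hs.trans (hball' hy)) subset_rfl)
      (fun y hy => norm_le_exp_on_ray hc hC hdecay hs (hball' (le_of_eq hy)).le)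
    exact (mul_le_mul_of_nonneg_right hd (pow_nonneg hs.le j)).trans_eq (by ring)
  · refine (ae_restrict_iff' measurableSet_Ioi).mpr (Filter.Eventually.of_forall fun s hs x hx => ?_)
    rw [Set.mem_Ioi] at hs
    have hx' : x + (s : ℂ) * Complex.I ∈ {τ : ℂ | 0 < τ.im} := by
      rw [Set.mem_ofPred_eq, add_mul_I_im]
      linarith [hball hx]
    have := (hhol.differentiableAt (hU.mem_nhds hx')).hasDerivAt
    exact (this.comp_add_const x _).mul_const _

theorem Ehat_eq_sum (hhol : DifferentiableOn ℂ h {τ : ℂ | 0 < τ.im}) (hC : 0 < C) (hc : 0 < c)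
    (hdecay : ∀ τ : ℂ, 0 < τ.im → ‖h τ‖ ≤ C * Real.exp (-c * τ.im)) {τ : ℂ} (hτ : 0 < τ.im)
    (n : ℕ) : Ehat n h τ = ∑ j ∈ Finset.range (n + 1), (n.choose j : ℂ) *
      ((starRingEnd ℂ) (τ - (starRingEnd ℂ) τ) ^ (n - j) * (starRingEnd ℂ) (rayMoment j h τ)) := by
  have : ∀ s : ℝ, h (τ + (s : ℂ) * Complex.I) *
        ((τ + (s : ℂ) * Complex.I) - (starRingEnd ℂ) τ) ^ n * Complex.I =
      ∑ j ∈ Finset.range (n + 1), (n.choose j : ℂ) * (τ - (starRingEnd ℂ) τ) ^ (n - j) *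
        (h (τ + (s : ℂ) * Complex.I) * (((s : ℂ) * Complex.I) ^ j * Complex.I)) := by
    intro s
    rw [show τ + (s : ℂ) * Complex.I - (starRingEnd ℂ) τ =
      (s : ℂ) * Complex.I + (τ - (starRingEnd ℂ) τ) by ring, add_pow, Finset.mul_sum,
      Finset.sum_mul]
    exact Finset.sum_congr rfl fun j _ => by ring
  simp only [Ehat, this]
  rw [integral_finsetSum _ fun j _ => (integrableOn_ray hhol hC hc hdecay hτ j).const_mul _, map_sum]
  refine Finset.sum_congr rfl fun j _ => ?_
  rw [integral_const_mul, map_mul, map_mul, map_pow, map_natCast, mul_assoc]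
  rfl

theorem hasWder_Ehat (hhol : DifferentiableOn ℂ h {τ : ℂ | 0 < τ.im}) (hC : 0 < C) (hc : 0 < c)
    (hdecay : ∀ τ : ℂ, 0 < τ.im → ‖h τ‖ ≤ C * Real.exp (-c * τ.im)) {τ : ℂ} (hτ : 0 < τ.im)
    (n : ℕ) : HasWder (Ehat n h) (-n * Ehat (n - 1) h τ) τ := by
  have hU : IsOpen {τ : ℂ | 0 < τ.im} := isOpen_lt continuous_const Complex.continuous_im
  have hsum := HasWder.sum (s := Finset.range (n + 1)) (fun j _ =>
    (((hasWder_conj_sub_conj τ).pow (n - j)).mul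
      (differentiableAt_rayMoment hhol hC hc hdecay hτ j).hasDerivAt.hasWder_conj).const_mul
        (n.choose j : ℂ))
  have := hsum.congr_of_eventuallyEq (g := Ehat n h)
    (Filter.eventually_of_mem (hU.mem_nhds hτ) fun w hw => Ehat_eq_sum hhol hC hc hdecay hw n)
  convert! this using 1
  cases n with
  | zero => simp
  | succ n =>
    rw [Nat.add_sub_cancel, Ehat_eq_sum hhol hC hc hdecay hτ n, Finset.sum_range_succ _ (n + 1),
      Finset.mul_sum]
    simp only [Nat.sub_self, Nat.cast_zero, zero_mul, mul_zero, add_zero]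
    refine Finset.sum_congr rfl fun j hj => ?_
    have h1 : ((n.choose j : ℕ) : ℂ) * ((n + 1 : ℕ) : ℂ) =
        ((n + 1).choose j : ℕ) * ((n + 1 - j : ℕ) : ℂ) := by
      exact_mod_cast Nat.choose_mul_succ_eq n j
    rw [show n + 1 - j - 1 = n - j by omega]
    linear_combination (-(starRingEnd ℂ) (τ - (starRingEnd ℂ) τ) ^ (n - j) *
      (starRingEnd ℂ) (rayMoment j h τ)) * h1

end

/-- If `F` agrees on `ℍ × ℂ` with a constant multiple of `∑ₐ Ê_n(hₐ) θ_{m,a}`, then the heat operator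
lowers `n` by one. -/
theorem heatOp_sum_Ehat_mul_theta {m : ℕ} (hm : 1 ≤ m) {ι : Type*} [Fintype ι] (b : ι → ℝ)
    {h : ι → ℂ → ℂ} (hhol : ∀ a, DifferentiableOn ℂ (h a) {τ : ℂ | 0 < τ.im})
    {C c : ℝ} (hC : 0 < C) (hc : 0 < c)
    (hdecay : ∀ a, ∀ τ : ℂ, 0 < τ.im → ‖h a τ‖ ≤ C * Real.exp (-c * τ.im)) (n : ℕ) (A : ℂ)
    {F : ℂ → ℂ → ℂ}
    (hF : ∀ τ z : ℂ, 0 < τ.im → F τ z = A * ∑ a, Ehat n (h a) τ * theta m (b a) τ z)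
    {τ : ℂ} (hτ : 0 < τ.im) (z : ℂ) :
    heatOp m F τ z = -(8 * (Real.pi : ℂ) * Complex.I * (m : ℂ) * n * A) *
      ∑ a, Ehat (n - 1) (h a) τ * theta m (b a) τ z := by
  have hU : IsOpen {τ : ℂ | 0 < τ.im} := isOpen_lt continuous_const Complex.continuous_im
  have hτder : HasWder (fun w => F w z) (A * ∑ a, (-n * Ehat (n - 1) (h a) τ * theta m (b a) τ z +
      Ehat n (h a) τ * deriv (fun w => theta m (b a) w z) τ)) τ :=
    ((HasWder.sum fun a _ => (hasWder_Ehat (hhol a) hC hc (hdecay a) hτ n).mul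
      (differentiableAt_theta_left hm (b a) hτ z).1.hasDerivAt.hasWder).const_mul
        A).congr_of_eventuallyEq
      (Filter.eventually_of_mem (hU.mem_nhds hτ) fun w hw => hF w z hw)
  have hFτ : F τ = fun z => A * ∑ a, Ehat n (h a) τ * theta m (b a) τ z :=
    funext fun z => hF τ z hτ
  have hz1 : wder (F τ) = fun z => A * ∑ a, Ehat n (h a) τ * deriv (theta m (b a) τ) z := by
    ext y
    rw [hFτ]
    exact ((HasWder.sum fun a _ => HasWder.const_mul _
      ((hasSum_deriv_theta_right hm (b a) hτ).1 y).hasDerivAt.hasWder).const_mul A).wder_eq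
  have hz2 : wder (wder (F τ)) z =
      A * ∑ a, Ehat n (h a) τ * deriv (deriv (theta m (b a) τ)) z := by
    rw [hz1]
    exact ((HasWder.sum fun a _ => HasWder.const_mul _
      ((hasSum_deriv_theta_right hm (b a) hτ).1.deriv z).hasDerivAt.hasWder).const_mul A).wder_eq
  rw [heatOp, hτder.wder_eq, hz2]
  simp only [← theta_heat_equation hm _ hτ, Finset.mul_sum, ← Finset.sum_sub_distrib]
  exact Finset.sum_congr rfl fun a _ => by ring

theorem heatOp_iterate_sum_Ehat_mul_theta {m : ℕ} (hm : 1 ≤ m) {ι : Type*} [Fintype ι]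
    (b : ι → ℝ) {h : ι → ℂ → ℂ} (hhol : ∀ a, DifferentiableOn ℂ (h a) {τ : ℂ | 0 < τ.im})
    {C c : ℝ} (hC : 0 < C) (hc : 0 < c)
    (hdecay : ∀ a, ∀ τ : ℂ, 0 < τ.im → ‖h a τ‖ ≤ C * Real.exp (-c * τ.im)) (n : ℕ) (A : ℂ)
    {F : ℂ → ℂ → ℂ}
    (hF : ∀ τ z : ℂ, 0 < τ.im → F τ z = A * ∑ a, Ehat n (h a) τ * theta m (b a) τ z)
    {τ : ℂ} (hτ : 0 < τ.im) (z : ℂ) : (heatOp m)^[n + 1] F τ z = 0 := by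
  have hstep := fun {τ : ℂ} (hτ : 0 < τ.im) (z : ℂ) =>
    heatOp_sum_Ehat_mul_theta hm b hhol hC hc hdecay n A hF hτ z
  induction n generalizing A F with
  | zero => simpa using hstep hτ z
  | succ n ih =>
    rw [Function.iterate_succ_apply]
    refine ih _ (fun w y hw => hstep hw y) ?_
    exact fun hw y => heatOp_sum_Ehat_mul_theta hm b hhol hC hc hdecay n _
      (fun w y hw => hstep hw y) hw y

/-- for holomorphic, exponentially decaying `h_a : ℍ → ℂ`, the
function `Φ(τ,z) = Σ_a Ê_{k−2}(h_a)(τ) θ_{m,a}(τ,z)` is annihilated by the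
`(k−1)`-fold iterate of the heat operator: `H_m^{k−1} Φ = 0` on `ℍ × ℂ`. -/
theorem heat_iterate_annihilates_Ehat_theta (k m : ℕ) (hk : 2 ≤ k) (hm : 1 ≤ m)
    (h : Fin (2 * m) → ℂ → ℂ)
    (hhol : ∀ a : Fin (2 * m), DifferentiableOn ℂ (h a) {τ : ℂ | 0 < τ.im})
    (hdecay : ∃ C c : ℝ, 0 < C ∧ 0 < c ∧
      ∀ a : Fin (2 * m), ∀ τ : ℂ, 0 < τ.im → ‖h a τ‖ ≤ C * Real.exp (-c * τ.im))
    (τ z : ℂ) (hτ : 0 < τ.im) :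
    (heatOp m)^[k - 1]
        (fun w y => ∑ a : Fin (2 * m),
          Ehat (k - 2) (h a) w * theta m (((a : ℕ) : ℝ) / (2 * m)) w y) τ z = 0 := by
  obtain ⟨C, c, hC, hc, hdec⟩ := hdecay
  obtain ⟨n, rfl⟩ := Nat.exists_eq_add_of_le hk
  rw [show 2 + n - 1 = n + 1 by omega, show 2 + n - 2 = n by omega]
  exact heatOp_iterate_sum_Ehat_mul_theta hm (fun a : Fin (2 * m) => ((a : ℕ) : ℝ) / (2 * m))
    hhol hC hc hdec n 1 (fun w y _ => (one_mul _).symm) hτ z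
end
end

section
/- Let k ≥ 2 be an even integer and let g, h be holomorphic functions on ℍ with |g(τ)| ≤ C e^{−c Im τ} and |h(τ)| ≤ C e^{−c Im τ} for some constants C, c > 0, which satisfy g(−1/τ) = τ^k h(τ) for all τ ∈ ℍ. Then for every τ ∈ ℍ, E_{k−2}(h)(τ) − τ^{k−2} E_{k−2}(g)(−1/τ) = ∫_0^{i∞} h(t)(t−τ)^{k−2} dt, where the right-hand integral is taken along the positive imaginary axis and converges absolutely. -/
open Complex MeasureTheory

noncomputable section

/-- The holomorphic Eichler integral
`E_n(f)(τ) = ∫_τ^{i∞} f(t)(t−τ)^n dt`, the integral taken along the vertical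
ray `t = τ + is`, `s ∈ (0,∞)` (so that `t − τ = is`). -/
def Eich (n : ℕ) (f : ℂ → ℂ) (τ : ℂ) : ℂ :=
  ∫ s in Set.Ioi (0:ℝ),
    f (τ + (s : ℂ) * Complex.I) * ((s : ℂ) * Complex.I) ^ n * Complex.I

open Set Filter Topology

/-- Exponential decay of `F` at `i∞`, uniformly on every vertical strip of the upper half-plane. -/
def StripDecay (F : ℂ → ℂ) : Prop :=
  ∀ R : ℝ, ∃ K c : ℝ, 0 < c ∧
    ∀ t : ℂ, 0 < t.im → |t.re| ≤ R → ‖F t‖ ≤ K * Real.exp (-c * t.im)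

lemma stripDecay_mul_sub_pow {f : ℂ → ℂ} {C c : ℝ} (hC : 0 < C) (hc : 0 < c)
    (hf : ∀ t : ℂ, 0 < t.im → ‖f t‖ ≤ C * Real.exp (-c * t.im)) (w : ℂ) (n : ℕ) :
    StripDecay fun t => f t * (t - w) ^ n := by
  intro R
  set M : ℝ := |R| + ‖w‖ + 1 with hM
  have hM0 : 0 < M := by positivity
  refine ⟨C * (M ^ n * ((2 / c) ^ n * (n.factorial * Real.exp (c / 2)))), c / 2, by positivity,
    fun t ht hR => ?_⟩
  have hsub : ‖t - w‖ ≤ M * (1 + t.im) := by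
    have h₁ := norm_sub_le t w
    have h₂ := Complex.norm_le_abs_re_add_abs_im t
    rw [abs_of_pos ht] at h₂
    have h₃ : (0 : ℝ) ≤ (|R| + ‖w‖) * t.im := by positivity
    nlinarith [le_abs_self R]
  have hexp : (c / 2 * (1 + t.im)) ^ n ≤ n.factorial * Real.exp (c / 2 * (1 + t.im)) := by
    have := Real.pow_div_factorial_le_exp (c / 2 * (1 + t.im)) (by positivity) n
    rwa [div_le_iff₀' (by positivity)] at this
  calc ‖f t * (t - w) ^ n‖
      ≤ C * Real.exp (-c * t.im) * (M * (1 + t.im)) ^ n := by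
        rw [norm_mul, norm_pow]
        gcongr
        exact hf t ht
    _ = C * Real.exp (-c * t.im) * (M ^ n * ((2 / c) ^ n * (c / 2 * (1 + t.im)) ^ n)) := by
        rw [← mul_pow, ← mul_pow]
        congr 2
        field_simp
    _ ≤ C * Real.exp (-c * t.im) *
          (M ^ n * ((2 / c) ^ n * (n.factorial * Real.exp (c / 2 * (1 + t.im))))) := by
        gcongr
    _ = C * (M ^ n * ((2 / c) ^ n * (n.factorial *
          (Real.exp (-c * t.im) * Real.exp (c / 2 * (1 + t.im)))))) := by ring
    _ = C * (M ^ n * ((2 / c) ^ n * (n.factorial * Real.exp (c / 2)))) *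
          Real.exp (-(c / 2) * t.im) := by
        rw [← Real.exp_add, show -c * t.im + c / 2 * (1 + t.im) = c / 2 + -(c / 2) * t.im by ring,
          Real.exp_add]
        ring

lemma integrableOn_vertical_ray {F : ℂ → ℂ} (hF : ContinuousOn F {t : ℂ | 0 < t.im})
    (hdecay : StripDecay F) {z : ℂ} (hz : 0 ≤ z.im) :
    IntegrableOn (fun s : ℝ => F (z + s * I) * I) (Ioi 0) := by
  obtain ⟨K, c, hc, hK⟩ := hdecay |z.re|
  have hmaps : MapsTo (fun s : ℝ => z + s * I) (Ioi 0) {t : ℂ | 0 < t.im} := fun s hs => by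
    simpa using add_pos_of_nonneg_of_pos hz hs
  refine Integrable.mono' ((exp_neg_integrableOn_Ioi 0 hc).const_mul (K * Real.exp (-c * z.im)))
    (ContinuousOn.aestronglyMeasurable ?_ measurableSet_Ioi) ?_
  · exact (hF.comp (by fun_prop) hmaps).mul continuousOn_const
  · filter_upwards [ae_restrict_mem measurableSet_Ioi] with s hs
    have := hK (z + s * I) (hmaps hs) (by simp)
    rw [norm_mul, norm_I, mul_one, mul_assoc, ← Real.exp_add]
    convert this using 3
    simp
    ring

lemma hasDerivAt_vertical_ray {F Φ : ℂ → ℂ} (hΦ : ∀ t : ℂ, 0 < t.im → HasDerivAt Φ (F t) t)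
    {z : ℂ} {s : ℝ} (hs : 0 < z.im + s) :
    HasDerivAt (fun s : ℝ => Φ (z + s * I)) (F (z + s * I) * I) s := by
  have h₁ : HasDerivAt (fun x : ℂ => z + x * I) I (s : ℂ) := by
    simpa using ((hasDerivAt_id (s : ℂ)).mul_const I).const_add z
  have h₂ : HasDerivAt Φ (F (z + s * I)) (z + s * I) := hΦ _ (by simpa using hs)
  exact (h₂.comp (s : ℂ) h₁).comp_ofReal

lemma tendsto_primitive_sub {F Φ : ℂ → ℂ} (hdecay : StripDecay F)
    (hΦ : ∀ t : ℂ, 0 < t.im → HasDerivAt Φ (F t) t) {z w : ℂ} (hz : 0 ≤ z.im) (hw : 0 ≤ w.im) :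
    Tendsto (fun T : ℝ => Φ (z + T * I) - Φ (w + T * I)) atTop (𝓝 0) := by
  obtain ⟨K, c, hc, hK⟩ := hdecay (max |z.re| |w.re|)
  have hlim : Tendsto (fun T : ℝ => |K| * Real.exp (-c * T) * ‖z - w‖) atTop (𝓝 0) := by
    have : Tendsto (fun T : ℝ => Real.exp (-c * T)) atTop (𝓝 0) :=
      Real.tendsto_exp_atBot.comp (tendsto_id.const_mul_atTop_of_neg (neg_neg_iff_pos.2 hc))
    simpa using (this.const_mul |K|).mul_const ‖z - w‖
  refine squeeze_zero_norm' ?_ hlim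
  filter_upwards [eventually_gt_atTop 0] with T hT
  set S : Set ℂ := {t | T ≤ t.im} ∩ re ⁻¹' Icc (-max |z.re| |w.re|) (max |z.re| |w.re|)
  have hconv : Convex ℝ S :=
    (convex_halfSpace_im_ge T).inter ((convex_Icc _ _).linear_preimage reLm)
  have hbound : ∀ t ∈ S, ‖F t‖ ≤ |K| * Real.exp (-c * T) := fun t ht => by
    have hTt : T ≤ t.im := ht.1
    refine (hK t (hT.trans_le hTt) (abs_le.2 ht.2)).trans ?_
    gcongr ?_ * Real.exp ?_
    · exact le_abs_self K
    · nlinarith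
  have hzS : z + T * I ∈ S := ⟨by simpa using hz, by
    simpa using abs_le.1 (le_max_left |z.re| |w.re|)⟩
  have hwS : w + T * I ∈ S := ⟨by simpa using hw, by
    simpa using abs_le.1 (le_max_right |z.re| |w.re|)⟩
  have := hconv.norm_image_sub_le_of_norm_hasDerivWithin_le
    (fun t ht => (hΦ t (hT.trans_le ht.1)).hasDerivWithinAt) hbound hwS hzS
  simpa using this

lemma exists_tendsto_primitive {F Φ : ℂ → ℂ} (hF : ContinuousOn F {t : ℂ | 0 < t.im})
    (hdecay : StripDecay F) (hΦ : ∀ t : ℂ, 0 < t.im → HasDerivAt Φ (F t) t) :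
    ∃ L : ℂ, ∀ z : ℂ, 0 ≤ z.im → Tendsto (fun T : ℝ => Φ (z + T * I)) atTop (𝓝 L) := by
  have hlim := tendsto_limUnder_of_hasDerivAt_of_integrableOn_Ioi
    (fun s (hs : 0 < s) => hasDerivAt_vertical_ray (z := 0) hΦ (by simpa using hs))
    (integrableOn_vertical_ray hF hdecay (z := 0) le_rfl)
  refine ⟨limUnder atTop fun T : ℝ => Φ (0 + T * I), fun z hz => ?_⟩
  simpa using (tendsto_primitive_sub hdecay hΦ hz (w := 0) le_rfl).add hlim

lemma integral_vertical_ray {F Φ : ℂ → ℂ} (hF : ContinuousOn F {t : ℂ | 0 < t.im})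
    (hdecay : StripDecay F) (hΦ : ∀ t : ℂ, 0 < t.im → HasDerivAt Φ (F t) t) {L z : ℂ}
    (hL : Tendsto (fun T : ℝ => Φ (z + T * I)) atTop (𝓝 L)) (hz : 0 < z.im) :
    ∫ s in Ioi (0 : ℝ), F (z + s * I) * I = L - Φ z := by
  have := integral_Ioi_of_hasDerivAt_of_tendsto'
    (fun s (hs : 0 ≤ s) => hasDerivAt_vertical_ray hΦ (by linarith))
    (integrableOn_vertical_ray hF hdecay hz.le) hL
  simpa using this

lemma integral_imaginary_axis {F Φ : ℂ → ℂ} (hF : ContinuousOn F {t : ℂ | 0 < t.im})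
    (hdecay : StripDecay F) (hΦ : ∀ t : ℂ, 0 < t.im → HasDerivAt Φ (F t) t) {L L₀ : ℂ}
    (hL : Tendsto (fun T : ℝ => Φ (T * I)) atTop (𝓝 L))
    (hL₀ : Tendsto (fun T : ℝ => Φ (T * I)) (𝓝[>] 0) (𝓝 L₀)) :
    ∫ s in Ioi (0 : ℝ), F (s * I) * I = L - L₀ := by
  have hint := integrableOn_vertical_ray hF hdecay (z := 0) le_rfl
  have hderiv : ∀ s ∈ Ioi (0 : ℝ), HasDerivAt (fun s : ℝ => Φ (s * I)) (F (s * I) * I) s :=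
    fun s (hs : 0 < s) => by
      simpa using hasDerivAt_vertical_ray (z := 0) hΦ (by simpa using hs)
  have := integral_Ioi_deriv_mul_eq_sub (a := 0) (a' := L₀) (b' := L) (v := fun _ => (1 : ℂ))
    (v' := fun _ => 0) hderiv (fun s _ => hasDerivAt_const s 1)
    (by simpa [Pi.mul_def, Pi.add_def] using hint)
    (by simpa [Pi.mul_def] using hL₀) (by simpa [Pi.mul_def] using hL)
  simpa using this

lemma neg_one_div_im_pos {u : ℂ} (hu : 0 < u.im) : 0 < (-1 / u).im := by
  have hu0 : u ≠ 0 := by rintro rfl; simp at hu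
  have : 0 < normSq u := normSq_pos.2 hu0
  rw [neg_div, one_div, neg_im, inv_im, neg_div, neg_neg]
  positivity

lemma hasDerivAt_comp_neg_one_div {n : ℕ} (hn : Even n) {g h Φ : ℂ → ℂ}
    (htrans : ∀ t : ℂ, 0 < t.im → g (-1 / t) = t ^ (n + 2) * h t) {τ : ℂ} (hτ : τ ≠ 0)
    (hΦ : ∀ t : ℂ, 0 < t.im → HasDerivAt Φ (h t * (t - τ) ^ n) t) {u : ℂ} (hu : 0 < u.im) :
    HasDerivAt (fun u => Φ (-1 / u) / τ ^ n) (g u * (u - -1 / τ) ^ n) u := by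
  have hu0 : u ≠ 0 := by rintro rfl; simp at hu
  have hinv : HasDerivAt (fun u : ℂ => -1 / u) (1 / u ^ 2) u := by
    simpa [div_eq_mul_inv] using (hasDerivAt_inv hu0).const_mul (-1)
  have hpos := neg_one_div_im_pos hu
  have hcomp := ((hΦ (-1 / u) hpos).comp u hinv).div_const (τ ^ n)
  have hgu : g u = (1 / u) ^ (n + 2) * h (-1 / u) := by
    have := htrans (-1 / u) hpos
    rwa [show -1 / (-1 / u) = u by field_simp, neg_div, (hn.add even_two).neg_pow,
      ← neg_div] at this
  have hsub : (-1 / u - τ) ^ n = (u - -1 / τ) ^ n * τ ^ n * (1 / u) ^ n := by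
    rw [← mul_pow, ← mul_pow, ← hn.neg_pow]
    congr 1
    field_simp
    ring
  refine hcomp.congr_deriv ?_
  rw [hgu, hsub, pow_add]
  field_simp

/-- for `k ≥ 2` even and holomorphic, exponentially decaying `g, h`
on `ℍ` with `g(−1/τ) = τ^k h(τ)`, one has, for every `τ ∈ ℍ`,
`E_{k−2}(h)(τ) − τ^{k−2} E_{k−2}(g)(−1/τ) = ∫_0^{i∞} h(t)(t−τ)^{k−2} dt`,
the right-hand integral taken along the positive imaginary axis and converging
absolutely. -/
theorem eichler_period_relation (k : ℕ) (hk : 2 ≤ k) (hke : Even k) (g h : ℂ → ℂ)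
    (hg : DifferentiableOn ℂ g {τ : ℂ | 0 < τ.im})
    (hh : DifferentiableOn ℂ h {τ : ℂ | 0 < τ.im})
    (hdecay : ∃ C c : ℝ, 0 < C ∧ 0 < c ∧
      (∀ τ : ℂ, 0 < τ.im → ‖g τ‖ ≤ C * Real.exp (-c * τ.im)) ∧
      (∀ τ : ℂ, 0 < τ.im → ‖h τ‖ ≤ C * Real.exp (-c * τ.im)))
    (htrans : ∀ τ : ℂ, 0 < τ.im → g (-1 / τ) = τ ^ k * h τ)
    (τ : ℂ) (hτ : 0 < τ.im) :
    IntegrableOn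
      (fun t : ℝ => h ((t : ℂ) * Complex.I) *
        ((t : ℂ) * Complex.I - τ) ^ (k - 2) * Complex.I) (Set.Ioi (0:ℝ)) ∧
    Eich (k - 2) h τ - τ ^ (k - 2) * Eich (k - 2) g (-1 / τ) =
      ∫ t in Set.Ioi (0:ℝ),
        h ((t : ℂ) * Complex.I) * ((t : ℂ) * Complex.I - τ) ^ (k - 2) * Complex.I := by
  obtain ⟨n, rfl⟩ : ∃ n, k = n + 2 := ⟨k - 2, by omega⟩
  have hn : Even n := by simpa [Nat.even_add] using hke
  simp only [Nat.add_sub_cancel]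
  obtain ⟨C, c, hC, hc, hgC, hhC⟩ := hdecay
  have hτ0 : τ ≠ 0 := by rintro rfl; simp at hτ
  set F : ℂ → ℂ := fun t => h t * (t - τ) ^ n with hF
  set G : ℂ → ℂ := fun u => g u * (u - -1 / τ) ^ n with hG
  have hFdiff : DifferentiableOn ℂ F {t : ℂ | 0 < t.im} := hh.mul (by fun_prop)
  have hGdiff : DifferentiableOn ℂ G {t : ℂ | 0 < t.im} := hg.mul (by fun_prop)
  have hFdecay : StripDecay F := stripDecay_mul_sub_pow hC hc hhC τ n
  have hGdecay : StripDecay G := stripDecay_mul_sub_pow hC hc hgC (-1 / τ) n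
  obtain ⟨Φ, hΦ'⟩ := (convex_halfSpace_im_gt 0).exists_forall_hasDerivWithinAt hFdiff
  have hΦ : ∀ t : ℂ, 0 < t.im → HasDerivAt Φ (F t) t := fun t ht =>
    (hΦ' t ht).hasDerivAt ((isOpen_lt continuous_const continuous_im).mem_nhds ht)
  have hΨ : ∀ u : ℂ, 0 < u.im → HasDerivAt (fun u => Φ (-1 / u) / τ ^ n) (G u) u :=
    fun u hu => hasDerivAt_comp_neg_one_div hn htrans hτ0 hΦ hu
  obtain ⟨L, hL⟩ := exists_tendsto_primitive hFdiff.continuousOn hFdecay hΦ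
  obtain ⟨M, hM⟩ := exists_tendsto_primitive hGdiff.continuousOn hGdecay hΨ
  have hEh : Eich n h τ = L - Φ τ := by
    rw [← integral_vertical_ray hFdiff.continuousOn hFdecay hΦ (hL τ hτ.le) hτ]
    simp [Eich, hF]
  have hpos := neg_one_div_im_pos hτ
  have hEg : Eich n g (-1 / τ) = M - Φ τ / τ ^ n := by
    have := integral_vertical_ray hGdiff.continuousOn hGdecay hΨ (hM _ hpos.le) hpos
    rw [show -1 / (-1 / τ) = τ by field_simp] at this
    rw [← this]
    simp [Eich, hG]
  have hzero : Tendsto (fun T : ℝ => Φ (T * I)) (𝓝[>] 0) (𝓝 (τ ^ n * M)) := by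
    refine (((hM 0 le_rfl).comp tendsto_inv_nhdsGT_zero).const_mul (τ ^ n)).congr fun T => ?_
    have hT : -1 / (0 + ((T⁻¹ : ℝ) : ℂ) * I) = T * I := by
      rw [zero_add, ofReal_inv, div_eq_mul_inv, mul_inv, inv_inv, inv_I]
      ring
    simp only [Function.comp_apply, hT]
    field_simp
  refine ⟨by simpa using integrableOn_vertical_ray hFdiff.continuousOn hFdecay (z := 0) le_rfl, ?_⟩
  rw [hEh, hEg, integral_imaginary_axis hFdiff.continuousOn hFdecay hΦ
    (by simpa using hL 0 le_rfl) hzero]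
  field_simp
  ring
end
end
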